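/- Let π_E denote the expert policy and π_bc denote any (imitator's) stationary policy. Assume the reward function is bounded in absolute value by R_max. Then |V^{π_bc} − V^{π_E}| ≤ (2 R_max/(1-γ)²) · E_{s ∼ d_{π_E}}[ D_TV(π_bc(·|s), π_E(·|s)) ]. -/

import Mathlib

open scoped BigOperators
open MeasureTheory

/-- A probability vector on a finite type: nonnegative entries summing to 1. -/
def IsProbVec {X : Type*} [Fintype X] (p : X → ℝ) : Prop :=
  (∀ x, 0 ≤ p x) ∧ ∑ x, p x = 1

/-- A stationary policy assigns to each state a probability distribution over actions. -/
def IsPolicy {S A : Type*} [Fintype A] (π : S → A → ℝ) : Prop :=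
  ∀ s, IsProbVec (π s)

/-- A transition kernel assigns to each state-action pair a distribution over next states. -/
def IsKernel {S A : Type*} [Fintype S] (P : S → A → S → ℝ) : Prop :=
  ∀ s a, IsProbVec (P s a)

/-- `stateDist P π d0 t s = Pr(s_t = s ; π, d0)`. -/
noncomputable def stateDist {S A : Type*} [Fintype S] [Fintype A]
    (P : S → A → S → ℝ) (π : S → A → ℝ) (d0 : S → ℝ) : ℕ → S → ℝ
  | 0 => d0
  | t + 1 => fun s' => ∑ s, ∑ a, stateDist P π d0 t s * π s a * P s a s'

/-- Discounted state distribution `d_π(s) = (1-γ) ∑_t γ^t Pr(s_t = s ; π, d0)`. -/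
noncomputable def discStateDist {S A : Type*} [Fintype S] [Fintype A] (γ : ℝ)
    (P : S → A → S → ℝ) (π : S → A → ℝ) (d0 : S → ℝ) : S → ℝ :=
  fun s => (1 - γ) * ∑' t : ℕ, γ ^ t * stateDist P π d0 t s

/-- Discounted state-action distribution
`ρ_π(s,a) = (1-γ) ∑_t γ^t Pr(s_t = s, a_t = a ; π, d0)`. -/
noncomputable def discSADist {S A : Type*} [Fintype S] [Fintype A] (γ : ℝ)
    (P : S → A → S → ℝ) (π : S → A → ℝ) (d0 : S → ℝ) : S × A → ℝ :=
  fun x => (1 - γ) * ∑' t : ℕ, γ ^ t * (stateDist P π d0 t x.1 * π x.1 x.2)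

/-- Total variation distance `D_TV(P,Q) = (1/2) ∑_x |P(x) - Q(x)|`. -/
noncomputable def DTV {X : Type*} [Fintype X] (p q : X → ℝ) : ℝ :=
  (1 / 2) * ∑ x, |p x - q x|

/-- Policy value `V^π = E[∑_t γ^t r(s_t,a_t)]`. -/
noncomputable def policyValue {S A : Type*} [Fintype S] [Fintype A] (γ : ℝ)
    (P : S → A → S → ℝ) (r : S → A → ℝ) (π : S → A → ℝ) (d0 : S → ℝ) : ℝ :=
  ∑' t : ℕ, γ ^ t * ∑ s, ∑ a, stateDist P π d0 t s * π s a * r s a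

lemma aux_summable (γ : ℝ) (hγ0 : 0 < γ) (hγ1 : γ < 1) (f : ℕ → ℝ) (C : ℝ)
    (hf : ∀ t, |f t| ≤ C) : Summable (fun t => γ ^ t * f t) := by
  have h1 : Summable (fun t : ℕ => γ ^ t * C) :=
    (summable_geometric_of_lt_one hγ0.le hγ1).mul_right C
  refine Summable.of_norm_bounded h1 (fun t => ?_)
  rw [Real.norm_eq_abs, abs_mul, abs_of_nonneg (pow_nonneg hγ0.le t)]
  exact mul_le_mul_of_nonneg_left (hf t) (pow_nonneg hγ0.le t)

lemma aux_stateDist {S A : Type*} [Fintype S] [Fintype A]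
    (P : S → A → S → ℝ) (hP : IsKernel P) (d0 : S → ℝ) (hd0 : IsProbVec d0)
    (π : S → A → ℝ) (hπ : IsPolicy π) (t : ℕ) : IsProbVec (stateDist P π d0 t) := by
  induction t with
  | zero => exact hd0
  | succ t ih =>
    constructor
    · intro s'
      exact Finset.sum_nonneg fun s _ => Finset.sum_nonneg fun a _ =>
        mul_nonneg (mul_nonneg (ih.1 s) ((hπ s).1 a)) ((hP s a).1 s')
    · simp only [stateDist]
      rw [Finset.sum_comm]
      have : ∀ s, ∑ s', ∑ a, stateDist P π d0 t s * π s a * P s a s' = stateDist P π d0 t s := by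
        intro s
        rw [Finset.sum_comm]
        simp_rw [← Finset.mul_sum, (hP s _).2, mul_one, ← Finset.mul_sum, (hπ s).2, mul_one]
      simp_rw [this]
      exact ih.2

/-- A finite-sum bound on the state-action discrepancy. -/
lemma aux_sa {S A : Type*} [Fintype S] [Fintype A] (p q : S → ℝ) (hq : ∀ s, 0 ≤ q s)
    (π μ : S → A → ℝ) (hπ : IsPolicy π) :
    ∑ s, ∑ a, |p s * π s a - q s * μ s a| ≤
      ∑ s, |p s - q s| + ∑ s, q s * ∑ a, |π s a - μ s a| := by
  rw [← Finset.sum_add_distrib]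
  refine Finset.sum_le_sum fun s _ => ?_
  have h : |p s - q s| = ∑ a, |p s - q s| * π s a := by
    rw [← Finset.mul_sum, (hπ s).2, mul_one]
  rw [h, Finset.mul_sum, ← Finset.sum_add_distrib]
  refine Finset.sum_le_sum fun a _ => ?_
  have e : p s * π s a - q s * μ s a = (p s - q s) * π s a + q s * (π s a - μ s a) := by ring
  rw [e]
  refine (abs_add_le _ _).trans ?_
  rw [abs_mul, abs_mul, abs_of_nonneg ((hπ s).1 a), abs_of_nonneg (hq s)]

lemma aux_l1 {X : Type*} [Fintype X] (p q : X → ℝ) (hp : IsProbVec p) (hq : IsProbVec q) :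
    ∑ x, |p x - q x| ≤ 2 := by
  calc ∑ x, |p x - q x| ≤ ∑ x, (p x + q x) := Finset.sum_le_sum fun x _ => by
        have := hp.1 x
        have := hq.1 x
        rw [abs_le]
        constructor <;> linarith
    _ = 2 := by rw [Finset.sum_add_distrib, hp.2, hq.2]; norm_num

lemma aux_pair {S A : Type*} [Fintype S] [Fintype A] (x y f : S → A → ℝ) (C : ℝ)
    (hf : ∀ s a, |f s a| ≤ C) :
    |∑ s, ∑ a, x s a * f s a - ∑ s, ∑ a, y s a * f s a| ≤ C * ∑ s, ∑ a, |x s a - y s a| := by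
  rw [← Finset.sum_sub_distrib, Finset.mul_sum]
  refine (Finset.abs_sum_le_sum_abs _ _).trans (Finset.sum_le_sum fun s _ => ?_)
  rw [← Finset.sum_sub_distrib, Finset.mul_sum]
  refine (Finset.abs_sum_le_sum_abs _ _).trans (Finset.sum_le_sum fun a _ => ?_)
  rw [← sub_mul, abs_mul, mul_comm]
  exact mul_le_mul_of_nonneg_right (hf s a) (abs_nonneg _)

lemma aux_step {S A : Type*} [Fintype S] [Fintype A] (P : S → A → S → ℝ) (hP : IsKernel P)
    (x y : S → A → ℝ) :
    ∑ s', |∑ s, ∑ a, x s a * P s a s' - ∑ s, ∑ a, y s a * P s a s'| ≤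
      ∑ s, ∑ a, |x s a - y s a| := by
  calc _ ≤ ∑ s', ∑ s, ∑ a, |x s a - y s a| * P s a s' := by
        refine Finset.sum_le_sum fun s' _ => ?_
        rw [← Finset.sum_sub_distrib]
        refine (Finset.abs_sum_le_sum_abs _ _).trans (Finset.sum_le_sum fun s _ => ?_)
        rw [← Finset.sum_sub_distrib]
        refine (Finset.abs_sum_le_sum_abs _ _).trans (Finset.sum_le_sum fun a _ => ?_)
        rw [← sub_mul, abs_mul, abs_of_nonneg ((hP s a).1 s')]
    _ = _ := by
        rw [Finset.sum_comm]
        refine Finset.sum_congr rfl fun s _ => ?_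
        rw [Finset.sum_comm]
        refine Finset.sum_congr rfl fun a _ => ?_
        rw [← Finset.mul_sum, (hP s a).2, mul_one]

lemma aux_reward {S A : Type*} [Fintype S] [Fintype A] (p : S → ℝ) (hp : IsProbVec p)
    (π : S → A → ℝ) (hπ : IsPolicy π) (f : S → A → ℝ) (C : ℝ) (hf : ∀ s a, |f s a| ≤ C) :
    |∑ s, ∑ a, p s * π s a * f s a| ≤ C := by
  have h := aux_pair (fun s a => p s * π s a) (fun _ _ => 0) f C hf
  have e : ∑ s, ∑ a, |p s * π s a - 0| = 1 := by
    have : ∀ s a, |p s * π s a - 0| = p s * π s a := fun s a => by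
      rw [sub_zero, abs_of_nonneg (mul_nonneg (hp.1 s) ((hπ s).1 a))]
    simp_rw [this, ← Finset.mul_sum, (hπ _).2, mul_one]
    exact hp.2
  rw [e] at h
  simpa using h

/-- Theorem 1: the behavioral cloning value gap is bounded by
`2 R_max/(1-γ)²` times the expected per-state policy total variation. -/
theorem bc_value_discrepancy {S A : Type*} [Fintype S] [Fintype A]
    (γ : ℝ) (hγ0 : 0 < γ) (hγ1 : γ < 1)
    (P : S → A → S → ℝ) (hP : IsKernel P)
    (d0 : S → ℝ) (hd0 : IsProbVec d0)
    (r : S → A → ℝ) (Rmax : ℝ) (hr : ∀ s a, |r s a| ≤ Rmax)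
    (πbc πE : S → A → ℝ) (hπbc : IsPolicy πbc) (hπE : IsPolicy πE) :
    |policyValue γ P r πbc d0 - policyValue γ P r πE d0| ≤
      2 * Rmax / (1 - γ) ^ 2 * ∑ s, discStateDist γ P πE d0 s * DTV (πbc s) (πE s) := by
  have hp := aux_stateDist P hP d0 hd0 πbc hπbc
  have hq := aux_stateDist P hP d0 hd0 πE hπE
  have hR : 0 ≤ Rmax := (abs_nonneg _).trans (aux_reward d0 hd0 πE hπE r Rmax hr)
  set p := stateDist P πbc d0 with hpdef
  set q := stateDist P πE d0 with hqdef
  set w : S → ℝ := fun s => ∑ a, |πbc s a - πE s a| with hw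
  set D : ℕ → ℝ := fun t => ∑ s, |p t s - q t s| with hD
  set e : ℕ → ℝ := fun t => ∑ s, q t s * w s with he
  have hw0 : ∀ s, 0 ≤ w s := fun s => Finset.sum_nonneg fun a _ => abs_nonneg _
  have hw2 : ∀ s, w s ≤ 2 := fun s => aux_l1 _ _ (hπbc s) (hπE s)
  have hD0 : ∀ t, 0 ≤ D t := fun t => Finset.sum_nonneg fun s _ => abs_nonneg _
  have hD2 : ∀ t, |D t| ≤ 2 := fun t => by
    rw [abs_of_nonneg (hD0 t)]
    exact aux_l1 _ _ (hp t) (hq t)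
  have he0 : ∀ t, 0 ≤ e t := fun t =>
    Finset.sum_nonneg fun s _ => mul_nonneg ((hq t).1 s) (hw0 s)
  have he2 : ∀ t, |e t| ≤ 2 := fun t => by
    rw [abs_of_nonneg (he0 t)]
    calc e t ≤ ∑ s, q t s * 2 :=
          Finset.sum_le_sum fun s _ => mul_le_mul_of_nonneg_left (hw2 s) ((hq t).1 s)
      _ = 2 := by rw [← Finset.sum_mul, (hq t).2, one_mul]
  have hsa : ∀ t, ∑ s, ∑ a, |p t s * πbc s a - q t s * πE s a| ≤ D t + e t := fun t =>
    aux_sa (p t) (q t) (hq t).1 πbc πE hπbc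
  have hstep : ∀ t, D (t + 1) ≤ D t + e t := fun t =>
    (aux_step P hP (fun s a => p t s * πbc s a) (fun s a => q t s * πE s a)).trans (hsa t)
  have hDz : D 0 = 0 := by simp [hD, hpdef, hqdef, stateDist]
  have sD := aux_summable γ hγ0 hγ1 D 2 hD2
  have se := aux_summable γ hγ0 hγ1 e 2 he2
  have sDe : Summable (fun t => γ ^ t * (D t + e t)) := by
    simpa only [mul_add] using sD.add se
  have hXE : ∑' t, γ ^ t * (D t + e t) = ∑' t, γ ^ t * D t + ∑' t, γ ^ t * e t := by
    rw [← sD.tsum_add se]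
    simp only [mul_add]
  have hX : ∑' t, γ ^ t * D t ≤ γ * ∑' t, γ ^ t * (D t + e t) := by
    rw [sD.tsum_eq_zero_add, hDz, mul_zero, zero_add, ← tsum_mul_left]
    refine Summable.tsum_le_tsum (fun t => ?_) ((summable_nat_add_iff 1).2 sD) (sDe.mul_left γ)
    rw [pow_succ', mul_assoc]
    exact mul_le_mul_of_nonneg_left
      (mul_le_mul_of_nonneg_left (hstep t) (pow_nonneg hγ0.le t)) hγ0.le
  have sp := aux_summable γ hγ0 hγ1 _ Rmax
    (fun t => aux_reward (p t) (hp t) πbc hπbc r Rmax hr)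
  have sq := aux_summable γ hγ0 hγ1 _ Rmax
    (fun t => aux_reward (q t) (hq t) πE hπE r Rmax hr)
  have hV : |policyValue γ P r πbc d0 - policyValue γ P r πE d0| ≤
      Rmax * ∑' t, γ ^ t * (D t + e t) := by
    unfold policyValue
    rw [← hpdef, ← hqdef, ← sp.tsum_sub sq, ← tsum_mul_left, ← Real.norm_eq_abs]
    refine tsum_of_norm_bounded (sDe.mul_left Rmax).hasSum (fun t => ?_)
    rw [Real.norm_eq_abs, ← mul_sub, abs_mul, abs_of_nonneg (pow_nonneg hγ0.le t),
      mul_left_comm]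
    refine mul_le_mul_of_nonneg_left ?_ (pow_nonneg hγ0.le t)
    exact (aux_pair (fun s a => p t s * πbc s a) (fun s a => q t s * πE s a) r Rmax hr).trans
      (mul_le_mul_of_nonneg_left (hsa t) hR)
  have sqs : ∀ s, Summable (fun t => γ ^ t * q t s) := fun s =>
    aux_summable γ hγ0 hγ1 (fun t => q t s) 1 fun t => by
      rw [abs_of_nonneg ((hq t).1 s), ← (hq t).2]
      exact Finset.single_le_sum (fun i _ => (hq t).1 i) (Finset.mem_univ s)
  have hE : ∑ s, discStateDist γ P πE d0 s * DTV (πbc s) (πE s) =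
      (1 - γ) / 2 * ∑' t, γ ^ t * e t := by
    have h1 : ∑' t, γ ^ t * e t = ∑ s, (∑' t, γ ^ t * q t s) * w s := by
      simp_rw [← tsum_mul_right]
      rw [← Summable.tsum_finsetSum fun s _ => (sqs s).mul_right (w s)]
      refine tsum_congr fun t => ?_
      simp only [he, Finset.mul_sum, mul_assoc]
    rw [h1, Finset.mul_sum]
    refine Finset.sum_congr rfl fun s _ => ?_
    simp only [discStateDist, DTV, ← hqdef, hw]
    ring
  rw [hE]
  have hg : 0 < 1 - γ := by linarith
  have hfin : ∑' t, γ ^ t * (D t + e t) ≤ (∑' t, γ ^ t * e t) / (1 - γ) := by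
    rw [le_div_iff₀ hg]
    linarith
  refine hV.trans ((mul_le_mul_of_nonneg_left hfin hR).trans (le_of_eq ?_))
  field_simp
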